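/- Assume 0 < λ ≤ Λ and that φ satisfies condition (φ_B). Let r* > 0 and M > 0. Then there exist constants m ≥ M, ν > 0 and k > 1, depending only on λ, Λ, n, φ, r*, M, such that for every y ∈ ℝⁿ and every 0 < r ≤ r* there is a C² function v on the annulus A_k = B(y,kr) ∖ closure(B(y,r)), continuous up to the closure of A_k, satisfying v = 0 on ∂B(y,r), v = m·r on ∂B(y,kr), ν⁻¹ ≤ |Dv(x)| ≤ ν for all x ∈ A_k, and v is a strict classical supersolution in A_k of F(x,u,Du,D²u) = 0 for every F satisfying (F1) and (F2A) with these λ, Λ, φ. -/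

import Mathlib

open Metric Set Filter MeasureTheory
open scoped Topology RealInnerProductSpace Classical

noncomputable section

/-- Euclidean space `ℝⁿ`. -/
abbrev Eucl (n : ℕ) := EuclideanSpace ℝ (Fin n)

/-- Real `n × n` matrices. -/
abbrev Mat (n : ℕ) := Matrix (Fin n) (Fin n) ℝ

variable {n : ℕ}

/-- Eigenvalues of a matrix (junk value `0` if the matrix is not symmetric). -/
noncomputable def eigenvals (X : Mat n) : Fin n → ℝ :=
  if h : X.IsHermitian then h.eigenvalues else 0

/-- The Pucci maximal operator `P⁺_{λ,Λ}(X) = -λ Σ_{eᵢ ≥ 0} eᵢ - Λ Σ_{eᵢ < 0} eᵢ`. -/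
noncomputable def pucciPlus (lam Lam : ℝ) (X : Mat n) : ℝ :=
  ∑ i, (if 0 ≤ eigenvals X i then -(lam * eigenvals X i) else -(Lam * eigenvals X i))

/-- The Pucci minimal operator `P⁻_{λ,Λ}(X) = -Λ Σ_{eᵢ ≥ 0} eᵢ - λ Σ_{eᵢ < 0} eᵢ`. -/
noncomputable def pucciMinus (lam Lam : ℝ) (X : Mat n) : ℝ :=
  ∑ i, (if 0 ≤ eigenvals X i then -(Lam * eigenvals X i) else -(lam * eigenvals X i))

/-- The positive semidefinite order `X ≤ Y` on symmetric matrices. -/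
def matLE (X Y : Mat n) : Prop := (Y - X).PosSemidef

/-- Structure condition (F1): `F(x,u,p,X) ≥ F(x,v,p,Y)` whenever `u ≥ v` and `X ≤ Y`. -/
def CondF1 (F : Eucl n → ℝ → Eucl n → Mat n → ℝ) : Prop :=
  ∀ x u v p X Y, v ≤ u → matLE X Y → F x v p Y ≤ F x u p X

/-- Structure condition (F2A): `-F(x,0,p,X) ≤ φ(|p|) - P⁻_{λ,Λ}(X)`. -/
def CondF2A (lam Lam : ℝ) (φ : ℝ → ℝ) (F : Eucl n → ℝ → Eucl n → Mat n → ℝ) : Prop :=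
  ∀ x p X, X.IsHermitian → -F x 0 p X ≤ φ ‖p‖ - pucciMinus lam Lam X

/-- Structure condition (F2B): `F(x,0,p,X) ≤ φ(|p|) + P⁺_{λ,Λ}(X)`. -/
def CondF2B (lam Lam : ℝ) (φ : ℝ → ℝ) (F : Eucl n → ℝ → Eucl n → Mat n → ℝ) : Prop :=
  ∀ x p X, X.IsHermitian → F x 0 p X ≤ φ ‖p‖ + pucciPlus lam Lam X

/-- Structure condition (F2B*): `F(x,r,p,X) ≤ φ(|p|) + P⁺_{λ,Λ}(X) + γ(r)` for `r > 0`. -/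
def CondF2Bstar (lam Lam : ℝ) (φ γF : ℝ → ℝ) (F : Eucl n → ℝ → Eucl n → Mat n → ℝ) : Prop :=
  ∀ x (r : ℝ) p X, 0 < r → X.IsHermitian →
    F x r p X ≤ φ ‖p‖ + pucciPlus lam Lam X + γF r

/-- `γ` is nonnegative and dominated by `φ`: `γ(r) ≤ C* φ(r)` whenever `0 < r ≤ 1`. -/
def GammaDominated (Cstar : ℝ) (φ γF : ℝ → ℝ) : Prop :=
  (∀ r : ℝ, 0 < r → 0 ≤ γF r) ∧ ∀ r : ℝ, 0 < r → r ≤ 1 → γF r ≤ Cstar * φ r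

/-- Standing assumptions on `φ : [0,∞) → [0,∞)`: continuous, strictly increasing and
`φ(t) ≥ t`. -/
def PhiAdmissible (φ : ℝ → ℝ) : Prop :=
  ContinuousOn φ (Ici 0) ∧ StrictMonoOn φ (Ici 0) ∧ ∀ t : ℝ, 0 ≤ t → t ≤ φ t

/-- The Osgood condition (φ_A): `∫₀¹ dt / φ(t) = ∞`, as divergence of the improper
Riemann integral. -/
def OsgoodCondition (φ : ℝ → ℝ) : Prop :=
  Tendsto (fun ε : ℝ => ∫ t in ε..1, 1 / φ t) (𝓝[>] 0) atTop

/-- Condition (φ_B): for every sufficiently small `ε > 0`, `∫₀^ε f_ν(t) dt → ∞` as `ν → ∞`,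
where `f_ν` solves `f' = -φ(f)`, `f(0) = ν`. -/
def CondPhiB (φ : ℝ → ℝ) : Prop :=
  ∃ ε₀ > (0:ℝ), ∀ ε : ℝ, 0 < ε → ε ≤ ε₀ → ∀ M : ℝ, 0 < M → ∃ ν₀ > (0:ℝ), ∀ ν : ℝ, ν₀ ≤ ν →
    ∀ f : ℝ → ℝ, (∀ t ∈ Icc (0:ℝ) ε, 0 ≤ f t) → f 0 = ν →
      (∀ t ∈ Icc (0:ℝ) ε, HasDerivAt f (-φ (f t)) t) →
      M ≤ ∫ t in (0:ℝ)..ε, f t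

/-- The Hessian matrix of a real valued function on Euclidean space. -/
noncomputable def hess (ψ : Eucl n → ℝ) (x : Eucl n) : Mat n :=
  Matrix.of fun i j =>
    iteratedFDeriv ℝ 2 ψ x ![EuclideanSpace.single i 1, EuclideanSpace.single j 1]

/-- Viscosity subsolution of `F(x,u,Du,D²u) = 0` in the open set `Ω`. -/
def ViscositySubsolution (F : Eucl n → ℝ → Eucl n → Mat n → ℝ) (Ω : Set (Eucl n))
    (u : Eucl n → ℝ) : Prop :=
  ∀ ψ : Eucl n → ℝ, ContDiffOn ℝ 2 ψ Ω → ∀ x₀ ∈ Ω,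
    IsLocalMaxOn (fun x => u x - ψ x) Ω x₀ →
    F x₀ (u x₀) (gradient ψ x₀) (hess ψ x₀) ≤ 0

/-- Viscosity supersolution of `F(x,u,Du,D²u) = 0` in the open set `Ω`. -/
def ViscositySupersolution (F : Eucl n → ℝ → Eucl n → Mat n → ℝ) (Ω : Set (Eucl n))
    (v : Eucl n → ℝ) : Prop :=
  ∀ ψ : Eucl n → ℝ, ContDiffOn ℝ 2 ψ Ω → ∀ x₀ ∈ Ω,
    IsLocalMinOn (fun x => v x - ψ x) Ω x₀ →
    0 ≤ F x₀ (v x₀) (gradient ψ x₀) (hess ψ x₀)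

/-- Strict classical (twice differentiable) subsolution on an open set. -/
def StrictClassicalSubsolution (F : Eucl n → ℝ → Eucl n → Mat n → ℝ) (Ω : Set (Eucl n))
    (u : Eucl n → ℝ) : Prop :=
  ContDiffOn ℝ 2 u Ω ∧ ∀ x ∈ Ω, F x (u x) (gradient u x) (hess u x) < 0

/-- Strict classical (twice differentiable) supersolution on an open set. -/
def StrictClassicalSupersolution (F : Eucl n → ℝ → Eucl n → Mat n → ℝ) (Ω : Set (Eucl n))
    (v : Eucl n → ℝ) : Prop :=
  ContDiffOn ℝ 2 v Ω ∧ ∀ x ∈ Ω, 0 < F x (v x) (gradient v x) (hess v x)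

/-- The interior ball condition at a boundary point `w` with radius `ri`. -/
def InteriorBallAt (Ω : Set (Eucl n)) (w : Eucl n) (ri : ℝ) : Prop :=
  ∃ y, ball y ri ⊆ Ω ∧ sphere y ri ∩ frontier Ω = {w}

/-- The interior ball condition (for all boundary points). -/
def InteriorBallCondition (Ω : Set (Eucl n)) (ri : ℝ) : Prop :=
  ∀ w ∈ frontier Ω, InteriorBallAt Ω w ri

/-- The exterior ball condition at a boundary point `w` with radius `re`. -/
def ExteriorBallAt (Ω : Set (Eucl n)) (w : Eucl n) (re : ℝ) : Prop :=
  ∃ y, ball y re ⊆ Ωᶜ ∧ sphere y re ∩ frontier Ω = {w}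

/-- The exterior ball condition (for all boundary points). -/
def ExteriorBallCondition (Ω : Set (Eucl n)) (re : ℝ) : Prop :=
  ∀ w ∈ frontier Ω, ExteriorBallAt Ω w re

/-- The ball condition: both the interior and the exterior ball condition. -/
def BallCondition (Ω : Set (Eucl n)) (rb : ℝ) : Prop :=
  InteriorBallCondition Ω rb ∧ ExteriorBallCondition Ω rb

/-- The annulus `B(y,R) ∖ closure B(y,r)`. -/
def annulus (y : Eucl n) (r R : ℝ) : Set (Eucl n) := ball y R \ closedBall y r

/-- The autonomous equation `f' = -ψ(f)` with `ψ` continuous and bounded between positive constants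
has a global decreasing solution through any initial value. -/
theorem exists_strictAnti_hasDerivAt_neg_comp {ψ : ℝ → ℝ} (hψ : Continuous ψ) {c D : ℝ}
    (hc : 0 < c) (hcψ : ∀ s, c ≤ ψ s) (hψD : ∀ s, ψ s ≤ D) (ν : ℝ) :
    ∃ f : ℝ → ℝ, StrictAnti f ∧ f 0 = ν ∧ (∀ t, HasDerivAt f (-ψ (f t)) t) ∧
      ∀ s, f (∫ σ in s..ν, 1 / ψ σ) = s := by
  have hpos : ∀ s, 0 < ψ s := fun s => hc.trans_le (hcψ s)
  have hD : 0 < D := (hpos 0).trans_le (hψD 0)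
  have hcont : Continuous fun s => 1 / ψ s := continuous_const.div hψ fun s => (hpos s).ne'
  set G : ℝ → ℝ := fun s => ∫ σ in ν..s, 1 / ψ σ with hG
  have hGd : ∀ s, HasDerivAt G (1 / ψ s) s := fun s =>
    intervalIntegral.integral_hasDerivAt_right (hcont.intervalIntegrable _ _)
      (hcont.stronglyMeasurableAtFilter _ _) hcont.continuousAt
  have hGc : Continuous G := continuous_iff_continuousAt.2 fun s => (hGd s).continuousAt
  have hGm : StrictMono G := strictMono_of_deriv_pos fun s => by
    rw [(hGd s).deriv]; exact one_div_pos.2 (hpos s)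
  have hmono : Monotone fun s => G s - s / D := by
    refine monotone_of_hasDerivAt_nonneg (f' := fun s => 1 / ψ s - 1 / D)
      (fun s => (hGd s).sub ((hasDerivAt_id s).div_const D)) fun s => ?_
    simpa using one_div_le_one_div_of_le (hpos s) (hψD s)
  have hGν : G ν = 0 := by simp [hG]
  have htop : Tendsto G atTop atTop := by
    refine tendsto_atTop_mono' _ (f₁ := fun s => s / D - ν / D) ?_
      (tendsto_atTop_add_const_right _ _ (tendsto_id.atTop_div_const hD))
    filter_upwards [eventually_ge_atTop ν] with s hs
    have := hmono hs
    simp only [hGν] at this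
    linarith
  have hbot : Tendsto G atBot atBot := by
    refine tendsto_atBot_mono' _ (f₁ := fun s => s / D - ν / D) ?_
      (tendsto_atBot_add_const_right _ _ (tendsto_id.atBot_div_const hD))
    filter_upwards [eventually_le_atBot ν] with s hs
    have := hmono hs
    simp only [hGν] at this
    linarith
  let e := hGm.orderIsoOfSurjective G (hGc.surjective htop hbot)
  have he : ∀ s, e.symm (G s) = s := fun s => e.symm_apply_apply s
  have he' : ∀ s, G (e.symm s) = s := fun s => e.apply_symm_apply s
  refine ⟨fun t => e.symm (-t), fun s t hst => e.symm.strictMono (neg_lt_neg hst), ?_,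
    fun t => ?_, fun s => ?_⟩
  · simpa [hGν] using he ν
  · have h1 : HasDerivAt (fun t => e.symm t) (1 / ψ (e.symm (-t)))⁻¹ (-t) :=
      HasDerivAt.of_local_left_inverse e.symm.continuous.continuousAt (hGd _)
        (one_div_pos.2 (hpos _)).ne' (Eventually.of_forall he')
    have h2 := h1.scomp t (hasDerivAt_neg t)
    simpa [Function.comp_def] using h2
  · have : -(∫ σ in s..ν, 1 / ψ σ) = G s := by
      rw [hG, intervalIntegral.integral_symm, neg_neg]
    simp only [this, he]

/-- Under the condition on `∫ f_ν`, there is a `C¹` solution of `f' = -φ(f)` on some interval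
`[0, ε]` that is bounded below by `1` and has arbitrarily large integral. -/
theorem exists_solution_large_integral {φ : ℝ → ℝ} (hφ : PhiAdmissible φ) (hB : CondPhiB φ)
    {K : ℝ} (hK : 0 < K) :
    ∃ (ε ν : ℝ) (f : ℝ → ℝ), 0 < ε ∧ ContDiff ℝ 1 f ∧
      (∀ t ∈ Icc 0 ε, 1 ≤ f t ∧ f t ≤ ν) ∧
      (∀ t ∈ Icc 0 ε, HasDerivAt f (-φ (f t)) t) ∧ K ≤ ∫ t in (0 : ℝ)..ε, f t := by
  obtain ⟨hφc, hφm, hφt⟩ := hφ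
  obtain ⟨ε₀, hε₀, H⟩ := hB
  have hφ2 : 0 < φ 2 := by linarith [hφt 2 (by norm_num)]
  have hε : 0 < min ε₀ (1 / φ 2) := lt_min hε₀ (one_div_pos.2 hφ2)
  obtain ⟨ν₀, -, hν₀⟩ := H _ hε (min_le_left _ _) K hK
  set ν := max ν₀ 2
  have hν2 : 2 ≤ ν := le_max_right _ _
  have hproj : ∀ s, 1 ≤ max 1 (min s ν) ∧ max 1 (min s ν) ≤ ν := fun s =>
    ⟨le_max_left _ _, max_le (by linarith) (min_le_right _ _)⟩
  have hψ : Continuous fun s => φ (max 1 (min s ν)) :=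
    hφc.comp_continuous (by fun_prop) fun s => by
      have := (hproj s).1
      simp only [mem_Ici]; linarith
  have hle : ∀ {a b : ℝ}, 0 ≤ a → a ≤ b → φ a ≤ φ b := fun ha hab =>
    hφm.monotoneOn ha (ha.trans hab) hab
  obtain ⟨f, hfa, hf0, hfd, hfi⟩ := exists_strictAnti_hasDerivAt_neg_comp hψ (c := 1) (D := φ ν)
    one_pos (fun s => (hproj s).1.trans (hφt _ (by linarith [(hproj s).1])))
    (fun s => hle (by linarith [(hproj s).1]) (hproj s).2) ν
  have hfC : ContDiff ℝ 1 f := by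
    refine contDiff_one_iff_deriv.2 ⟨fun t => (hfd t).differentiableAt, ?_⟩
    have hfc : Continuous f := continuous_iff_continuousAt.2 fun t => (hfd t).continuousAt
    have : deriv f = fun t => -φ (max 1 (min (f t) ν)) := funext fun t => (hfd t).deriv
    rw [this]
    exact (hψ.comp hfc).neg
  have hcont : Continuous fun s => 1 / φ (max 1 (min s ν)) :=
    continuous_const.div hψ fun s => by
      have h1 := (hproj s).1
      have := hφt _ (by linarith : (0 : ℝ) ≤ max 1 (min s ν))
      linarith
  have hpos : ∀ s, 0 ≤ 1 / φ (max 1 (min s ν)) := fun s => by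
    have h1 := (hproj s).1
    have := hφt _ (by linarith : (0 : ℝ) ≤ max 1 (min s ν))
    exact one_div_nonneg.2 (by linarith)
  have hint : 1 / φ 2 ≤ ∫ σ in (1 : ℝ)..ν, 1 / φ (max 1 (min σ ν)) := by
    rw [← intervalIntegral.integral_add_adjacent_intervals (b := 2)
      (hcont.intervalIntegrable _ _) (hcont.intervalIntegrable _ _)]
    have h1 : 1 / φ 2 ≤ ∫ σ in (1 : ℝ)..2, 1 / φ (max 1 (min σ ν)) := by
      calc 1 / φ 2 = ∫ σ in (1 : ℝ)..2, 1 / φ 2 := by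
            rw [intervalIntegral.integral_const]; norm_num
        _ ≤ _ := by
            refine intervalIntegral.integral_mono_on (by norm_num) intervalIntegrable_const
              (hcont.intervalIntegrable _ _) fun σ hσ => ?_
            have h1 := (hproj σ).1
            have := hφt _ (by linarith : (0 : ℝ) ≤ max 1 (min σ ν))
            refine one_div_le_one_div_of_le (by linarith) (hle (by linarith) ?_)
            exact max_le (by norm_num) ((min_le_left _ _).trans hσ.2)
    have h2 : 0 ≤ ∫ σ in (2 : ℝ)..ν, 1 / φ (max 1 (min σ ν)) :=
      intervalIntegral.integral_nonneg hν2 fun σ _ => hpos σ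
    linarith
  have hbd : ∀ t ∈ Icc 0 (min ε₀ (1 / φ 2)), 1 ≤ f t ∧ f t ≤ ν := fun t ht => by
    refine ⟨?_, hf0 ▸ hfa.antitone ht.1⟩
    rw [← hfi 1]
    exact hfa.antitone ((ht.2.trans (min_le_right _ _)).trans hint)
  have hd : ∀ t ∈ Icc 0 (min ε₀ (1 / φ 2)), HasDerivAt f (-φ (f t)) t := fun t ht => by
    have := hfd t
    rwa [min_eq_left (hbd t ht).2, max_eq_right (hbd t ht).1] at this
  exact ⟨_, ν, f, hε, hfC, hbd, hd,
    hν₀ ν (le_max_left _ _) f (fun t ht => by linarith [(hbd t ht).1]) hf0 hd⟩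

/-- A lower bound for the Pucci minimal operator from the trace and an upper bound on the
quadratic form. -/
theorem le_pucciMinus {n : ℕ} {lam Lam a : ℝ} (hlamLam : lam ≤ Lam) {X : Mat n}
    (hX : X.IsHermitian) (ha : 0 ≤ a) (hXa : ∀ w, w ⬝ᵥ X.mulVec w ≤ a * (w ⬝ᵥ w)) :
    -lam * X.trace - (Lam - lam) * (n * a) ≤ pucciMinus lam Lam X := by
  have he : ∀ i, hX.eigenvalues i ≤ a := fun i => by
    have h1 := hXa (hX.eigenvectorBasis i)
    have h2 : (hX.eigenvectorBasis i).ofLp ⬝ᵥ (hX.eigenvectorBasis i).ofLp = 1 := by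
      have := hX.eigenvectorBasis.orthonormal.1 i
      rw [EuclideanSpace.norm_eq, Real.sqrt_eq_one] at this
      simpa [dotProduct, sq] using this
    rw [hX.mulVec_eigenvectorBasis, dotProduct_smul, h2] at h1
    simpa using h1
  have htr : X.trace = ∑ i, hX.eigenvalues i := by simpa using hX.trace_eq_sum_eigenvalues
  have hcard : (n : ℝ) * a = ∑ _i : Fin n, a := by simp
  rw [pucciMinus, htr, hcard, Finset.mul_sum, Finset.mul_sum, ← Finset.sum_sub_distrib]
  refine Finset.sum_le_sum fun i _ => ?_
  have hi := he i
  simp only [eigenvals, dif_pos hX]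
  split_ifs with h0 <;> nlinarith

section Radial

variable {y x : Eucl n} {g g' g'' : ℝ → ℝ}

theorem hasFDerivAt_norm_sub (hx : x ≠ y) :
    HasFDerivAt (fun z : Eucl n => ‖z - y‖) (‖x - y‖⁻¹ • innerSL ℝ (x - y)) x := by
  have hz : ‖x - y‖ ≠ 0 := norm_ne_zero_iff.2 (sub_ne_zero.2 hx)
  have h1 : HasFDerivAt (fun z : Eucl n => ‖z - y‖ ^ 2) (2 • innerSL ℝ (x - y)) x := by
    simpa using ((hasFDerivAt_id x).sub_const y).norm_sq
  have h2 := h1.sqrt (pow_ne_zero 2 hz)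
  simp only [Real.sqrt_sq (norm_nonneg _)] at h2
  refine h2.congr_fderiv ?_
  ext w
  simp
  field_simp

theorem hasFDerivAt_radial (hx : x ≠ y) (hg : HasDerivAt g (g' ‖x - y‖) ‖x - y‖) :
    HasFDerivAt (fun z : Eucl n => g ‖z - y‖) ((g' ‖x - y‖ / ‖x - y‖) • innerSL ℝ (x - y)) x := by
  refine (hg.comp_hasFDerivAt x (hasFDerivAt_norm_sub hx)).congr_fderiv ?_
  rw [smul_smul, div_eq_mul_inv]

theorem gradient_radial (hx : x ≠ y) (hg : HasDerivAt g (g' ‖x - y‖) ‖x - y‖) :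
    gradient (fun z : Eucl n => g ‖z - y‖) x = (g' ‖x - y‖ / ‖x - y‖) • (x - y) := by
  refine HasGradientAt.gradient ?_
  rw [hasGradientAt_iff_hasFDerivAt]
  refine (hasFDerivAt_radial hx hg).congr_fderiv ?_
  ext w
  simp

theorem hess_radial (hx : x ≠ y) (hg : ∀ᶠ ρ in 𝓝 ‖x - y‖, HasDerivAt g (g' ρ) ρ)
    (hg' : HasDerivAt g' (g'' ‖x - y‖) ‖x - y‖) :
    hess (fun z : Eucl n => g ‖z - y‖) x =
      (g' ‖x - y‖ / ‖x - y‖) • (1 : Mat n) +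
        ((g'' ‖x - y‖ - g' ‖x - y‖ / ‖x - y‖) / ‖x - y‖ ^ 2) •
          Matrix.vecMulVec (x - y).ofLp (x - y).ofLp := by
  have hz : ‖x - y‖ ≠ 0 := norm_ne_zero_iff.2 (sub_ne_zero.2 hx)
  have hcont : ContinuousAt (fun z : Eucl n => ‖z - y‖) x := by fun_prop
  have h1 : fderiv ℝ (fun z : Eucl n => g ‖z - y‖) =ᶠ[𝓝 x]
      fun z => (g' ‖z - y‖ / ‖z - y‖) • innerSL ℝ (z - y) := by
    filter_upwards [hcont.eventually hg, isOpen_ne.mem_nhds hx] with z h1 h2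
    exact (hasFDerivAt_radial h2 h1).fderiv
  have hq : HasDerivAt (fun ρ => g' ρ / ρ)
      ((g'' ‖x - y‖ * ‖x - y‖ - g' ‖x - y‖ * 1) / ‖x - y‖ ^ 2) ‖x - y‖ :=
    hg'.div (hasDerivAt_id _) hz
  have h2 := hq.comp_hasFDerivAt x (hasFDerivAt_norm_sub hx)
  have h3 : HasFDerivAt (fun z : Eucl n => innerSL ℝ (z - y)) (innerSL ℝ) x :=
    (innerSL ℝ (E := Eucl n)).hasFDerivAt.comp x ((hasFDerivAt_id x).sub_const y)
  have h4 := h2.smul h3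
  simp only [Function.comp_def] at h4
  ext i j
  simp only [hess, Matrix.of_apply, iteratedFDeriv_two_apply, h1.fderiv_eq]
  have h5 : fderiv ℝ (fun z : Eucl n => (g' ‖z - y‖ / ‖z - y‖) • innerSL ℝ (z - y)) x = _ :=
    h4.fderiv
  have h6 : innerSL ℝ (EuclideanSpace.single i (1 : ℝ)) (EuclideanSpace.single j 1) =
      if i = j then 1 else 0 := by
    rw [innerSL_apply_apply]
    simp [EuclideanSpace.inner_single_right, eq_comm]
  rw [h5]
  simp only [add_apply, smul_apply,
    ContinuousLinearMap.smulRight_apply, Matrix.cons_val_zero, Matrix.cons_val_one, smul_eq_mul,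
    h6, Matrix.add_apply, Matrix.smul_apply, Matrix.one_apply, Matrix.vecMulVec_apply]
  simp [EuclideanSpace.inner_single_right]
  field_simp

end Radial

theorem isHermitian_smul_one_add_smul_vecMulVec (a c : ℝ) (z : Fin n → ℝ) :
    (a • (1 : Mat n) + c • Matrix.vecMulVec z z).IsHermitian := by
  ext i j
  simp [Matrix.vecMulVec_apply, Matrix.one_apply, eq_comm, mul_comm]

/-- The Pucci minimal operator of the Hessian of an increasing concave radial function. -/
theorem radial_le_pucciMinus {lam Lam a b : ℝ} (hlam : 0 ≤ lam) (hlamLam : lam ≤ Lam)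
    {z : Eucl n} (hz : z ≠ 0) (ha : 0 ≤ a) (hb : b ≤ 0) :
    -lam * b - Lam * n * a ≤ pucciMinus lam Lam
      (a • (1 : Mat n) + ((b - a) / ‖z‖ ^ 2) • Matrix.vecMulVec z.ofLp z.ofLp) := by
  have hz' : ‖z‖ ≠ 0 := norm_ne_zero_iff.2 hz
  have hzz : z.ofLp ⬝ᵥ z.ofLp = ‖z‖ ^ 2 := by
    rw [EuclideanSpace.real_norm_sq_eq]; simp [dotProduct, sq]
  have key := le_pucciMinus hlamLam (a := a)
    (isHermitian_smul_one_add_smul_vecMulVec a ((b - a) / ‖z‖ ^ 2) z.ofLp) ha fun w => by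
      have h1 : (b - a) / ‖z‖ ^ 2 * (w ⬝ᵥ z.ofLp) ^ 2 ≤ 0 :=
        mul_nonpos_of_nonpos_of_nonneg
          (div_nonpos_of_nonpos_of_nonneg (by linarith) (by positivity)) (sq_nonneg _)
      simp only [Matrix.add_mulVec, Matrix.smul_mulVec, Matrix.one_mulVec,
        Matrix.vecMulVec_mulVec, dotProduct_add, dotProduct_smul, smul_eq_mul,
        MulOpposite.smul_eq_mul_unop, MulOpposite.unop_op, dotProduct_comm z.ofLp w]
      nlinarith
  have htr : (a • (1 : Mat n) + ((b - a) / ‖z‖ ^ 2) • Matrix.vecMulVec z.ofLp z.ofLp).trace =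
      a * n + (b - a) := by
    rw [Matrix.trace_add, Matrix.trace_smul, Matrix.trace_smul, Matrix.trace_vecMulVec, hzz]
    simp [hz']
  rw [htr] at key
  nlinarith

/-- Lemma 3.3: large strict classical supersolution barrier in an annulus,
under the structure condition (F2A) and condition (φ_B). -/
theorem barrier_large_supersolution
    {n : ℕ} (lam Lam : ℝ) (hlam : 0 < lam) (hlamLam : lam ≤ Lam)
    (φ : ℝ → ℝ) (hφ : PhiAdmissible φ) (hB : CondPhiB φ)
    (rstar M : ℝ) (hrstar : 0 < rstar) (hM : 0 < M) :
    ∃ m ν k : ℝ, M ≤ m ∧ 0 < ν ∧ 1 < k ∧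
      ∀ (y : Eucl n) (r : ℝ), 0 < r → r ≤ rstar →
        ∃ vh : Eucl n → ℝ,
          ContDiffOn ℝ 2 vh (annulus y r (k*r)) ∧
          ContinuousOn vh (closure (annulus y r (k*r))) ∧
          (∀ x ∈ sphere y r, vh x = 0) ∧
          (∀ x ∈ sphere y (k*r), vh x = m*r) ∧
          (∀ x ∈ annulus y r (k*r), ν⁻¹ ≤ ‖gradient vh x‖ ∧ ‖gradient vh x‖ ≤ ν) ∧
          (∀ F : Eucl n → ℝ → Eucl n → Mat n → ℝ, CondF1 F → CondF2A lam Lam φ F →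
            StrictClassicalSupersolution F (annulus y r (k*r)) vh) := by
  have hLam : 0 < Lam := hlam.trans_le hlamLam
  set C : ℝ := (Lam * n + rstar + 1) / lam with hCdef
  have hC : 0 < C := by positivity
  have hClam : lam * C = Lam * n + rstar + 1 := by rw [hCdef]; field_simp
  obtain ⟨ε, ν, f, hε, hfC, hfb, hfd, hfi⟩ :=
    exists_solution_large_integral hφ hB (mul_pos hC hM)
  have hν : 1 ≤ ν := (hfb 0 ⟨le_rfl, hε.le⟩).1.trans (hfb 0 ⟨le_rfl, hε.le⟩).2
  have hfc : Continuous f := hfC.continuous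
  refine ⟨(∫ t in (0 : ℝ)..ε, f t) / C, ν, 1 + ε / C, (le_div_iff₀' hC).2 hfi, by linarith,
    by linarith [div_pos hε hC], fun y r hr hrr => ?_⟩
  set g : ℝ → ℝ := fun ρ => r / C * ∫ t in (0 : ℝ)..C / r * (ρ - r), f t with hg
  have hlin : ∀ ρ, HasDerivAt (fun ρ => C / r * (ρ - r)) (C / r) ρ := fun ρ => by
    simpa using ((hasDerivAt_id ρ).sub_const r).const_mul (C / r)
  have hgd : ∀ ρ, HasDerivAt g (f (C / r * (ρ - r))) ρ := fun ρ => by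
    have h1 := intervalIntegral.integral_hasDerivAt_right
      (hfc.intervalIntegrable 0 (C / r * (ρ - r)))
      (hfc.stronglyMeasurableAtFilter _ _) hfc.continuousAt
    refine ((h1.comp ρ (hlin ρ)).const_mul (r / C)).congr_deriv ?_
    field_simp
  have hg2 : ContDiff ℝ 2 g := by
    rw [show (2 : WithTop ℕ∞) = 1 + 1 by norm_num, contDiff_succ_iff_deriv]
    refine ⟨fun ρ => (hgd ρ).differentiableAt, by simp, ?_⟩
    rw [show deriv g = fun ρ => f (C / r * (ρ - r)) from funext fun ρ => (hgd ρ).deriv]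
    exact hfC.comp (by fun_prop)
  have hann : ∀ x ∈ annulus y r ((1 + ε / C) * r),
      r < ‖x - y‖ ∧ x ≠ y ∧ C / r * (‖x - y‖ - r) ∈ Icc 0 ε := fun x hx => by
    have h1 : ‖x - y‖ < (1 + ε / C) * r := mem_ball_iff_norm.1 hx.1
    have h2 : r < ‖x - y‖ := by simpa [dist_eq_norm] using hx.2
    refine ⟨h2, fun h => ?_, ?_, ?_⟩
    · rw [h, sub_self, norm_zero] at h2; linarith
    · have := sub_pos.2 h2
      positivity
    · calc C / r * (‖x - y‖ - r) ≤ C / r * ((1 + ε / C) * r - r) := by gcongr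
        _ = ε := by field_simp; ring
  have hsmooth : ContDiffOn ℝ 2 (fun x => g ‖x - y‖) (annulus y r ((1 + ε / C) * r)) :=
    fun x hx => (hg2.contDiffAt.comp x
      ((contDiffAt_id.sub contDiffAt_const).norm ℝ
        (sub_ne_zero.2 (hann x hx).2.1))).contDiffWithinAt
  refine ⟨fun x => g ‖x - y‖, hsmooth, ?_, fun x hx => ?_, fun x hx => ?_, fun x hx => ?_,
    fun F hF1 hF2 => ⟨hsmooth, fun x hx => ?_⟩⟩
  · exact (hg2.continuous.comp (by fun_prop : Continuous fun x => ‖x - y‖)).continuousOn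
  · simp [hg, mem_sphere_iff_norm.1 hx]
  · have : C / r * ((1 + ε / C) * r - r) = ε := by field_simp; ring
    simp only [hg, mem_sphere_iff_norm.1 hx, this]
    ring
  · obtain ⟨h1, h2, h3⟩ := hann x hx
    have hρ : 0 < ‖x - y‖ := hr.trans h1
    have hb := hfb _ h3
    rw [gradient_radial (g' := fun ρ => f (C / r * (ρ - r))) h2 (hgd _), norm_smul,
      Real.norm_of_nonneg (div_nonneg (by linarith) hρ.le), div_mul_cancel₀ _ hρ.ne']
    exact ⟨(inv_le_one_of_one_le₀ hν).trans hb.1, hb.2⟩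
  · obtain ⟨h1, h2, h3⟩ := hann x hx
    have hρ : 0 < ‖x - y‖ := hr.trans h1
    have hb := hfb _ h3
    have hgrad := gradient_radial (g' := fun ρ => f (C / r * (ρ - r))) h2 (hgd _)
    have hhess := hess_radial (g' := fun ρ => f (C / r * (ρ - r)))
      (g'' := fun ρ => -φ (f (C / r * (ρ - r))) * (C / r)) h2
      (Eventually.of_forall hgd) ((hfd _ h3).comp ‖x - y‖ (hlin ‖x - y‖))
    have hnorm : ‖gradient (fun z : Eucl n => g ‖z - y‖) x‖ = f (C / r * (‖x - y‖ - r)) := by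
      rw [hgrad, norm_smul, Real.norm_of_nonneg (div_nonneg (by linarith) hρ.le),
        div_mul_cancel₀ _ hρ.ne']
    have hgnn : 0 ≤ g ‖x - y‖ := mul_nonneg (by positivity) <|
      intervalIntegral.integral_nonneg h3.1 fun t ht => by
        linarith [(hfb t ⟨ht.1, ht.2.trans h3.2⟩).1]
    set X := hess (fun z : Eucl n => g ‖z - y‖) x
    have hXX : matLE X X := by simpa [matLE] using Matrix.PosSemidef.zero
    refine lt_of_lt_of_le ?_ (hF1 x _ 0 _ _ _ hgnn hXX)
    have hherm : X.IsHermitian := by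
      rw [hhess]
      exact isHermitian_smul_one_add_smul_vecMulVec _ _ _
    have hF := hF2 x (gradient (fun z : Eucl n => g ‖z - y‖) x) _ hherm
    rw [hnorm] at hF
    have hφf : f (C / r * (‖x - y‖ - r)) ≤ φ (f (C / r * (‖x - y‖ - r))) :=
      hφ.2.2 _ (by linarith)
    generalize f (C / r * (‖x - y‖ - r)) = h at *
    have hφh : 0 < φ h := by linarith
    have hP := radial_le_pucciMinus hlam.le hlamLam (sub_ne_zero.2 h2)
      (a := h / ‖x - y‖) (b := -φ h * (C / r)) (div_nonneg (by linarith) hρ.le)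
      (by rw [neg_mul]; exact neg_nonpos.2 (by positivity))
    rw [← hhess] at hP
    have ha : h / ‖x - y‖ ≤ φ h / r := by gcongr
    have hLa : Lam * n * (h / ‖x - y‖) ≤ Lam * n * (φ h / r) := by gcongr
    have hφr : φ h ≤ rstar * (φ h / r) := by
      rw [← mul_div_assoc, le_div_iff₀ hr]
      nlinarith
    have hCe : -lam * (-φ h * (C / r)) = (Lam * n + rstar + 1) * (φ h / r) := by
      rw [← hClam]; ring
    have hpos : 0 < φ h / r := div_pos hφh hr
    linarith
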